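/- Let Φ = (0,0,0,0,0,1) ∈ ℝ⁶ (a prismatic joint along the z-axis). Then the set {π ∈ ℝ^10 : Φᵀ·[π]^∧ = 0 and (Φ×)ᵀ·[π]^∧ + [π]^∧·(Φ×) = 0} equals {π ∈ ℝ^10 : m = h_x = h_y = h_z = 0}; in particular it is a subspace of ℝ^10 of dimension 6, consisting of arbitrary changes to the rotational mass moments and products of inertia with zero net mass and unaltered first moments. (This is the paper's computation of the six transfer degrees of freedom across a prismatic joint.) -/

import Mathlib

open Matrix

noncomputable section

/-- 3×3 skew-symmetric cross-product matrix `S(x)`, satisfying `S(x) y = x × y`. -/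
def skew3 (x : Fin 3 → ℝ) : Matrix (Fin 3) (Fin 3) ℝ :=
  !![0, -x 2, x 1; x 2, 0, -x 0; -x 1, x 0, 0]

/-- The angular (top) part of a 6D spatial vector. -/
def angPart (v : Fin 6 → ℝ) : Fin 3 → ℝ := fun i => v ⟨i, by omega⟩

/-- The linear (bottom) part of a 6D spatial vector. -/
def linPart (v : Fin 6 → ℝ) : Fin 3 → ℝ := fun i => v ⟨(i : ℕ) + 3, by omega⟩

/-- 6×6 spatial cross-product matrix `(v×) = [[S(ω), 0], [S(u), S(ω)]]`. -/
def spCross (v : Fin 6 → ℝ) : Matrix (Fin 6) (Fin 6) ℝ :=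
  Matrix.reindex (finSumFinEquiv : Fin 3 ⊕ Fin 3 ≃ Fin 6)
    (finSumFinEquiv : Fin 3 ⊕ Fin 3 ≃ Fin 6)
    (Matrix.fromBlocks (skew3 (angPart v)) 0 (skew3 (linPart v)) (skew3 (angPart v)))

/-- Spatial inertia matrix `[π]^∧ = [[Ī, S(h)], [S(h)ᵀ, m·1₃]]` built from the ten
inertial parameters `π = (m, hx, hy, hz, Ixx, Ixy, Ixz, Iyy, Iyz, Izz)`. -/
def wedge (π : Fin 10 → ℝ) : Matrix (Fin 6) (Fin 6) ℝ :=
  Matrix.reindex (finSumFinEquiv : Fin 3 ⊕ Fin 3 ≃ Fin 6)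
    (finSumFinEquiv : Fin 3 ⊕ Fin 3 ≃ Fin 6)
    (Matrix.fromBlocks !![π 4, π 5, π 6; π 5, π 7, π 8; π 6, π 8, π 9]
      (skew3 ![π 1, π 2, π 3]) (skew3 ![π 1, π 2, π 3])ᵀ
      (π 0 • (1 : Matrix (Fin 3) (Fin 3) ℝ)))

lemma wedge_eq (π : Fin 10 → ℝ) :
    wedge π = !![π 4, π 5, π 6, 0, -π 3, π 2;
                 π 5, π 7, π 8, π 3, 0, -π 1;
                 π 6, π 8, π 9, -π 2, π 1, 0;
                 0, π 3, -π 2, π 0, 0, 0;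
                 -π 3, 0, π 1, 0, π 0, 0;
                 π 2, -π 1, 0, 0, 0, π 0] := by
  rw [wedge, ← Equiv.eq_symm_apply]
  ext (i | i) (j | j) <;> fin_cases i <;> fin_cases j <;>
    simp [skew3, finSumFinEquiv, Fin.castAdd, Fin.natAdd, Fin.castLE]

lemma spCross_prismatic :
    spCross ![0, 0, 0, 0, 0, 1] = !![0, 0, 0, 0, 0, 0;
                                     0, 0, 0, 0, 0, 0;
                                     0, 0, 0, 0, 0, 0;
                                     0, -1, 0, 0, 0, 0;
                                     1, 0, 0, 0, 0, 0;
                                     0, 0, 0, 0, 0, 0] := by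
  rw [spCross, ← Equiv.eq_symm_apply]
  ext (i | i) (j | j) <;> fin_cases i <;> fin_cases j <;>
    simp [skew3, angPart, linPart, finSumFinEquiv, Fin.castAdd, Fin.natAdd, Fin.castLE]

lemma prismatic_conditions_iff (π : Fin 10 → ℝ) :
    ((![0, 0, 0, 0, 0, 1] : Fin 6 → ℝ) ᵥ* wedge π = 0 ∧
        (spCross ![0, 0, 0, 0, 0, 1])ᵀ * wedge π
          + wedge π * spCross ![0, 0, 0, 0, 0, 1] = 0) ↔
      π 0 = 0 ∧ π 1 = 0 ∧ π 2 = 0 ∧ π 3 = 0 := by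
  rw [wedge_eq, spCross_prismatic]
  constructor
  · rintro ⟨hv, hM⟩
    have h0 := congrFun hv 5
    have h1 := congrFun hv 1
    have h2 := congrFun hv 0
    have h3 := congrFun (congrFun hM 0) 0
    simp [Matrix.vecMul, dotProduct, Matrix.mul_apply, Fin.sum_univ_succ] at h0 h1 h2 h3
    refine ⟨?_, ?_, ?_, ?_⟩ <;> linarith
  · rintro ⟨h0, h1, h2, h3⟩
    simp only [h0, h1, h2, h3, neg_zero]
    constructor
    · ext i
      fin_cases i <;> simp [Matrix.vecMul, dotProduct, Fin.sum_univ_succ]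
    · ext i j
      fin_cases i <;> fin_cases j <;> simp [Matrix.mul_apply, Fin.sum_univ_succ]

lemma finrank_ker_funLeft {K m n : Type*} [Field K] [Fintype m] [Fintype n] {f : m → n}
    (hf : Function.Injective f) :
    Module.finrank K (LinearMap.ker (LinearMap.funLeft K K f)) =
      Fintype.card n - Fintype.card m := by
  have h := (LinearMap.funLeft K K f).finrank_range_add_finrank_ker
  rw [LinearMap.range_eq_top.2 (LinearMap.funLeft_surjective_of_injective K K f hf),
    finrank_top, Module.finrank_fintype_fun_eq_card, Module.finrank_fintype_fun_eq_card] at h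
  omega

/-- The undetectable transfer freedoms across a prismatic joint along the z-axis:
the parameters satisfying both the momentum condition `Φᵀ·[π]^∧ = 0` and the
invariance condition `(Φ×)ᵀ·[π]^∧ + [π]^∧·(Φ×) = 0` are exactly those with
`m = hx = hy = hz = 0`; in particular they form a subspace of `ℝ^10` of dimension 6. -/
theorem prismatic_transfer_freedoms :
    ({π : Fin 10 → ℝ | (![0, 0, 0, 0, 0, 1] : Fin 6 → ℝ) ᵥ* wedge π = 0 ∧
        (spCross ![0, 0, 0, 0, 0, 1])ᵀ * wedge π
          + wedge π * spCross ![0, 0, 0, 0, 0, 1] = 0}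
      = {π : Fin 10 → ℝ | π 0 = 0 ∧ π 1 = 0 ∧ π 2 = 0 ∧ π 3 = 0}) ∧
    ∃ U : Submodule ℝ (Fin 10 → ℝ),
      (↑U = {π : Fin 10 → ℝ | (![0, 0, 0, 0, 0, 1] : Fin 6 → ℝ) ᵥ* wedge π = 0 ∧
        (spCross ![0, 0, 0, 0, 0, 1])ᵀ * wedge π
          + wedge π * spCross ![0, 0, 0, 0, 0, 1] = 0}) ∧
      Module.finrank ℝ U = 6 := by
  have hset : {π : Fin 10 → ℝ | (![0, 0, 0, 0, 0, 1] : Fin 6 → ℝ) ᵥ* wedge π = 0 ∧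
        (spCross ![0, 0, 0, 0, 0, 1])ᵀ * wedge π
          + wedge π * spCross ![0, 0, 0, 0, 0, 1] = 0}
      = {π : Fin 10 → ℝ | π 0 = 0 ∧ π 1 = 0 ∧ π 2 = 0 ∧ π 3 = 0} :=
    Set.ext prismatic_conditions_iff
  refine ⟨hset, LinearMap.ker (LinearMap.funLeft ℝ ℝ (![0, 1, 2, 3] : Fin 4 → Fin 10)), ?_, ?_⟩
  · rw [hset]
    ext π
    simp [funext_iff, Fin.forall_fin_succ, LinearMap.funLeft_apply]
  · rw [finrank_ker_funLeft (by decide)]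
    simp
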